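/- Let R be a ring and n ≥ 2, d ∈ ℕ* ∪ {∞}. A left R-module M is FP_n^{≤d}-injective if and only if its character module M^♭ = Hom_ℤ(M, ℚ/ℤ) is FP_n^{≤d}-flat as a right R-module. -/

import Mathlib

universe u

/-- `M` is a finitely `n`-presented `R`-module. -/
def FinNPres (R : Type u) [Ring R] : ℕ → (M : Type u) → [AddCommGroup M] → [Module R M] → Prop
  | 0, M, _, _ => Module.Finite R M
  | n+1, M, _, _ => ∃ (k : ℕ) (f : (Fin k → R) →ₗ[R] M), Function.Surjective f ∧
      FinNPres R n (LinearMap.ker f)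

/-- `M` has projective dimension at most `d` (finite `d`). -/
def ProjDimLE (R : Type u) [Ring R] : ℕ → (M : Type u) → [AddCommGroup M] → [Module R M] → Prop
  | 0, M, _, _ => Module.Projective R M
  | d+1, M, _, _ => ∃ (ι : Type u) (f : (ι →₀ R) →ₗ[R] M), Function.Surjective f ∧
      ProjDimLE R d (LinearMap.ker f)

/-- Projective dimension at most `d` for `d : ℕ∞`; `d = ⊤` imposes no condition. -/
def ProjDimLE' (R : Type u) [Ring R] (d : ℕ∞) (M : Type u) [AddCommGroup M] [Module R M] : Prop :=
  ∀ k : ℕ, (k : ℕ∞) = d → ProjDimLE R k M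

/-- `Ext¹_R(M, N) = 0`, expressed by the splitting of all extensions of `M` by `N`. -/
def Ext1Zero (R : Type u) [Ring R] (M N : Type u) [AddCommGroup M] [Module R M]
    [AddCommGroup N] [Module R N] : Prop :=
  ∀ (X : Type u) [AddCommGroup X] [Module R X] (i : N →ₗ[R] X) (p : X →ₗ[R] M),
    Function.Injective i → Function.Surjective p → LinearMap.range i = LinearMap.ker p →
    ∃ r : X →ₗ[R] N, r ∘ₗ i = LinearMap.id

/-- `N` is `FPₙ^{≤d}`-injective: `Ext¹_R(K, N) = 0` for every finitely `n`-presented `K`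
of projective dimension at most `d`. -/
def FPdInj (R : Type u) [Ring R] (n : ℕ) (d : ℕ∞) (N : Type u)
    [AddCommGroup N] [Module R N] : Prop :=
  ∀ (K : Type u) [AddCommGroup K] [Module R K],
    FinNPres R n K → ProjDimLE' R d K → Ext1Zero R K N

/-- `M` is `FPₙ^{≤d}`-projective: `Ext¹_R(M, N) = 0` for every `FPₙ^{≤d}`-injective `N`. -/
def FPdProj (R : Type u) [Ring R] (n : ℕ) (d : ℕ∞) (M : Type u)
    [AddCommGroup M] [Module R M] : Prop :=
  ∀ (N : Type u) [AddCommGroup N] [Module R N], FPdInj R n d N → Ext1Zero R M N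

open TensorProduct in
/-- The subgroup of `F ⊗[ℤ] K` generated by the middle-linearity relations for the right
`R`-module `F` and the left `R`-module `K`. -/
noncomputable def brel (R : Type u) [Ring R] (F K : Type u) [AddCommGroup F] [Module Rᵐᵒᵖ F]
    [AddCommGroup K] [Module R K] : AddSubgroup (F ⊗[ℤ] K) :=
  AddSubgroup.closure {x | ∃ (a : F) (r : R) (k : K),
    x = (MulOpposite.op r • a) ⊗ₜ[ℤ] k - a ⊗ₜ[ℤ] (r • k)}

open TensorProduct in
/-- The balanced tensor product `F ⊗[R] K` of a right `R`-module `F` and a left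
`R`-module `K`, realized as a quotient of `F ⊗[ℤ] K`. -/
def BTen (R : Type u) [Ring R] (F K : Type u) [AddCommGroup F] [Module Rᵐᵒᵖ F]
    [AddCommGroup K] [Module R K] : Type u :=
  (F ⊗[ℤ] K) ⧸ brel R F K

noncomputable instance (R : Type u) [Ring R] (F K : Type u) [AddCommGroup F] [Module Rᵐᵒᵖ F]
    [AddCommGroup K] [Module R K] : AddCommGroup (BTen R F K) :=
  QuotientAddGroup.Quotient.addCommGroup _

/-- Functoriality of the balanced tensor product in the left-module variable. -/
noncomputable def BTen.mapRight (R : Type u) [Ring R] (F : Type u) {K K' : Type u}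
    [AddCommGroup F] [Module Rᵐᵒᵖ F] [AddCommGroup K] [Module R K] [AddCommGroup K']
    [Module R K'] (g : K →ₗ[R] K') : BTen R F K →+ BTen R F K' :=
  QuotientAddGroup.map _ _
    (TensorProduct.map LinearMap.id g.toAddMonoidHom.toIntLinearMap).toAddMonoidHom
    (by
      refine (AddSubgroup.closure_le _).2 ?_
      rintro x ⟨a, r, k, rfl⟩
      simp only [SetLike.mem_coe, AddSubgroup.mem_comap, LinearMap.toAddMonoidHom_coe,
        map_sub, TensorProduct.map_tmul, AddMonoidHom.coe_toIntLinearMap,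
        LinearMap.id_coe, id_eq, LinearMap.map_smul]
      exact AddSubgroup.subset_closure ⟨a, r, g k, rfl⟩)

/-- `Tor₁^R(F, K) = 0` for a right `R`-module `F` and a left `R`-module `K`: for any
projective presentation `0 → Ω → P → K → 0`, the map `F ⊗ Ω → F ⊗ P` is injective. -/
def Tor1Zero (R : Type u) [Ring R] (F K : Type u) [AddCommGroup F] [Module Rᵐᵒᵖ F]
    [AddCommGroup K] [Module R K] : Prop :=
  ∀ (P : Type u) [AddCommGroup P] [Module R P], Module.Projective R P →
    ∀ (p : P →ₗ[R] K), Function.Surjective p →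
      Function.Injective (BTen.mapRight R F (LinearMap.ker p).subtype)

/-- The right `R`-module `F` is `FPₙ^{≤d}`-flat: `Tor₁^R(F, K) = 0` for every finitely
`n`-presented left `R`-module `K` of projective dimension at most `d`. -/
def FPdFlat (R : Type u) [Ring R] (n : ℕ) (d : ℕ∞) (F : Type u)
    [AddCommGroup F] [Module Rᵐᵒᵖ F] : Prop :=
  ∀ (K : Type u) [AddCommGroup K] [Module R K],
    FinNPres R n K → ProjDimLE' R d K → Tor1Zero R F K

/-- The character module `M⋆ = Hom_ℤ(M, ℚ/ℤ)`. -/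
def CharMod (M : Type u) [AddCommGroup M] : Type u := M →+ AddCircle (1 : ℚ)

instance (M : Type u) [AddCommGroup M] : AddCommGroup (CharMod M) :=
  inferInstanceAs (AddCommGroup (M →+ AddCircle (1 : ℚ)))

instance (M : Type u) [AddCommGroup M] : FunLike (CharMod M) M (AddCircle (1 : ℚ)) :=
  inferInstanceAs (FunLike (M →+ AddCircle (1 : ℚ)) M (AddCircle (1 : ℚ)))

instance (M : Type u) [AddCommGroup M] :
    AddMonoidHomClass (CharMod M) M (AddCircle (1 : ℚ)) :=
  inferInstanceAs (AddMonoidHomClass (M →+ AddCircle (1 : ℚ)) M (AddCircle (1 : ℚ)))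

/-- The character module of a left `R`-module is a right `R`-module via
`(f • r) m = f (r • m)`. -/
instance charModRight (R : Type u) [Ring R] (M : Type u) [AddCommGroup M] [Module R M] :
    Module Rᵐᵒᵖ (CharMod M) where
  smul r f := (f : M →+ AddCircle (1 : ℚ)).comp
    (DistribMulAction.toAddMonoidHom M r.unop)
  one_smul f := AddMonoidHom.ext fun m => by
    show f ((1 : Rᵐᵒᵖ).unop • m) = f m
    rw [MulOpposite.unop_one, one_smul]
  mul_smul r s f := AddMonoidHom.ext fun m => by
    show f ((r * s).unop • m) = f (s.unop • r.unop • m)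
    rw [MulOpposite.unop_mul, mul_smul]
  smul_zero r := rfl
  smul_add r f g := rfl
  add_smul r s f := AddMonoidHom.ext fun m => by
    show f ((r + s).unop • m) = f (r.unop • m) + f (s.unop • m)
    rw [MulOpposite.unop_add, add_smul, map_add]
  zero_smul f := AddMonoidHom.ext fun m => by
    show f ((0 : Rᵐᵒᵖ).unop • m) = 0
    rw [MulOpposite.unop_zero, zero_smul, map_zero]

namespace FPdAux

abbrev QZ : Type := AddCircle (1 : ℚ)

theorem char_ext {A B : Type u} [AddCommGroup A] [AddCommGroup B] (f : A →+ B)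
    (hf : Function.Injective f) (φ : A →+ QZ) : ∃ ψ : B →+ QZ, ∀ a, ψ (f a) = φ a := by
  obtain ⟨ψ, h⟩ := CharacterModule.dual_surjective_of_injective (R := ℤ) f.toIntLinearMap hf φ
  exact ⟨ψ, fun a => DFunLike.congr_fun h a⟩

theorem char_ext_ker {A B : Type u} [AddCommGroup A] [AddCommGroup B] (f : A →+ B)
    (φ : A →+ QZ) (hφ : ∀ a, f a = 0 → φ a = 0) : ∃ ψ : B →+ QZ, ∀ a, ψ (f a) = φ a := by
  obtain ⟨ψ, h⟩ := char_ext (QuotientAddGroup.kerLift f) (QuotientAddGroup.kerLift_injective f)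
    (QuotientAddGroup.lift f.ker φ (fun a ha => hφ a ha))
  exact ⟨ψ, fun a => h (QuotientAddGroup.mk a)⟩

/-- A homomorphism is surjective if every character vanishing on its range is zero. -/
theorem surj_of_char {A B : Type u} [AddCommGroup A] [AddCommGroup B] (f : A →+ B)
    (h : ∀ φ : B →+ QZ, (∀ a, φ (f a) = 0) → φ = 0) : Function.Surjective f := by
  intro b
  by_contra hb
  have hne : (QuotientAddGroup.mk b : B ⧸ f.range) ≠ 0 := by
    intro h0
    exact hb ((QuotientAddGroup.eq_zero_iff b).1 h0)
  obtain ⟨c, hc⟩ := CharacterModule.exists_character_apply_ne_zero_of_ne_zero hne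
  apply hc
  have h1 := h (AddMonoidHom.comp (c : (B ⧸ f.range) →+ QZ) (QuotientAddGroup.mk' f.range)) (by
    intro a
    have : (QuotientAddGroup.mk (f a) : B ⧸ f.range) = 0 :=
      (QuotientAddGroup.eq_zero_iff _).2 ⟨a, rfl⟩
    show c (QuotientAddGroup.mk (f a)) = 0
    rw [this, map_zero])
  exact DFunLike.congr_fun h1 b

section BT
variable {R : Type u} [Ring R] {F : Type u} [AddCommGroup F] [Module Rᵐᵒᵖ F]
  {K K' K'' : Type u} [AddCommGroup K] [Module R K] [AddCommGroup K'] [Module R K']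
  [AddCommGroup K''] [Module R K'']

open TensorProduct in
noncomputable def tm (R : Type u) [Ring R] {F K : Type u} [AddCommGroup F] [Module Rᵐᵒᵖ F]
    [AddCommGroup K] [Module R K] (a : F) (k : K) : BTen R F K :=
  QuotientAddGroup.mk (s := brel R F K) (a ⊗ₜ[ℤ] k)

theorem tm_add_left (a b : F) (k : K) : tm R (a + b) k = tm R a k + tm R b k :=
  congrArg (QuotientAddGroup.mk (s := brel R F K)) (TensorProduct.add_tmul a b k)

theorem tm_add_right (a : F) (k l : K) : tm R a (k + l) = tm R a k + tm R a l :=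
  congrArg (QuotientAddGroup.mk (s := brel R F K)) (TensorProduct.tmul_add a k l)

theorem tm_zero_left (k : K) : tm R (0 : F) k = 0 :=
  congrArg (QuotientAddGroup.mk (s := brel R F K)) (TensorProduct.zero_tmul _ k)

theorem tm_smul (a : F) (r : R) (k : K) : tm R (MulOpposite.op r • a) k = tm R a (r • k) := by
  refine (QuotientAddGroup.eq_iff_sub_mem (N := brel R F K)).2 ?_
  exact AddSubgroup.subset_closure ⟨a, r, k, rfl⟩

theorem tm_sum_right {ι : Type} (s : Finset ι) (a : F) (k : ι → K) :
    tm R a (∑ i ∈ s, k i) = ∑ i ∈ s, tm R a (k i) := 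
  map_sum (AddMonoidHom.mk' (fun x => tm R a x) (tm_add_right a)) k s

theorem bt_ind {P : BTen R F K → Prop} (h0 : P 0) (h1 : ∀ a k, P (tm R a k))
    (h2 : ∀ x y, P x → P y → P (x + y)) (x : BTen R F K) : P x := by
  obtain ⟨t, rfl⟩ := QuotientAddGroup.mk_surjective (s := brel R F K) x
  induction t using TensorProduct.induction_on with
  | zero => exact h0
  | tmul a k => exact h1 a k
  | add x y hx hy => exact h2 _ _ hx hy

theorem map_tm (g : K →ₗ[R] K') (a : F) (k : K) :
    BTen.mapRight R F g (tm R a k) = tm R a (g k) := rfl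

theorem map_map (g : K →ₗ[R] K') (h : K' →ₗ[R] K'') (x : BTen R F K) :
    BTen.mapRight R F h (BTen.mapRight R F g x) = BTen.mapRight R F (h ∘ₗ g) x := by
  induction x using bt_ind with
  | h0 => simp
  | h1 a k => rfl
  | h2 x y hx hy => simp [hx, hy]

theorem map_add' (g h : K →ₗ[R] K') (x : BTen R F K) :
    BTen.mapRight R F (g + h) x = BTen.mapRight R F g x + BTen.mapRight R F h x := by
  induction x using bt_ind with
  | h0 => simp
  | h1 a k => exact tm_add_right a (g k) (h k)
  | h2 x y hx hy => simp only [map_add, hx, hy]; abel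

theorem map_id' (x : BTen R F K) : BTen.mapRight R F (LinearMap.id : K →ₗ[R] K) x = x := by
  induction x using bt_ind with
  | h0 => simp
  | h1 a k => rfl
  | h2 x y hx hy => simp [hx, hy]

theorem map_zero' (x : BTen R F K) : BTen.mapRight R F (0 : K →ₗ[R] K') x = 0 := by
  have := map_add' (0 : K →ₗ[R] K') 0 x
  rw [add_zero] at this
  exact left_eq_add.1 this

theorem map_surj (g : K →ₗ[R] K') (hg : Function.Surjective g) :
    Function.Surjective (BTen.mapRight R F g) := by
  intro x
  induction x using bt_ind with
  | h0 => exact ⟨0, map_zero _⟩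
  | h1 a k =>
    obtain ⟨l, rfl⟩ := hg k
    exact ⟨tm R a l, rfl⟩
  | h2 x y hx hy =>
    obtain ⟨x, rfl⟩ := hx
    obtain ⟨y, rfl⟩ := hy
    exact ⟨x + y, map_add _ _ _⟩

/-- Independence of the presentation. -/
theorem tor_indep {P : Type u} [AddCommGroup P] [Module R P] [Module.Projective R P]
    (p : P →ₗ[R] K) (hp : Function.Surjective p)
    (hinj : Function.Injective (BTen.mapRight R F (LinearMap.ker p).subtype)) :
    Tor1Zero R F K := by
  intro P' _ _ hP' p' hp'
  obtain ⟨h, hh⟩ := Module.projective_lifting_property p' p hp'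
  obtain ⟨h', hh'⟩ := Module.projective_lifting_property p p' hp
  have e (x) : p' (h x) = p x := DFunLike.congr_fun hh x
  have e' (x) : p (h' x) = p' x := DFunLike.congr_fun hh' x
  rw [injective_iff_map_eq_zero]
  intro t ht
  let u' : LinearMap.ker p' →ₗ[R] LinearMap.ker p :=
    h'.restrict (fun x hx => by rw [LinearMap.mem_ker, e']; exact hx)
  let u : LinearMap.ker p →ₗ[R] LinearMap.ker p' :=
    h.restrict (fun x hx => by rw [LinearMap.mem_ker, e]; exact hx)
  let v : P' →ₗ[R] LinearMap.ker p' :=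
    (LinearMap.id - h ∘ₗ h').codRestrict _ (fun x => by simp [e, e'])
  have h1 : BTen.mapRight R F u' t = 0 := by
    apply hinj
    rw [map_zero, map_map]
    have : (LinearMap.ker p).subtype ∘ₗ u' = h' ∘ₗ (LinearMap.ker p').subtype := rfl
    rw [this, ← map_map, ht, map_zero]
  have h2 : (LinearMap.id : LinearMap.ker p' →ₗ[R] LinearMap.ker p') =
      u ∘ₗ u' + v ∘ₗ (LinearMap.ker p').subtype := by
    ext x
    simp [u, u', v]
  rw [← map_id' t, h2, map_add', ← map_map, ← map_map, h1, ht, map_zero, map_zero, add_zero]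

end BT

section Tau
variable {R : Type u} [Ring R] (M : Type u) [AddCommGroup M] [Module R M]
  {A B : Type u} [AddCommGroup A] [Module R A] [AddCommGroup B] [Module R B]

/-- The natural map `M⋆ ⊗ A → Hom(A, M)⋆`. -/
noncomputable def tau (A : Type u) [AddCommGroup A] [Module R A] :
    BTen R (CharMod M) A →+ ((A →ₗ[R] M) →+ QZ) :=
  QuotientAddGroup.lift (brel R (CharMod M) A)
    (TensorProduct.liftAddHom
      (AddMonoidHom.mk' (fun a : CharMod M => AddMonoidHom.mk' (fun k : A =>
        AddMonoidHom.mk' (fun h : A →ₗ[R] M => a (h k))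
          (fun h h' => by rw [LinearMap.add_apply, map_add]))
          (fun k l => AddMonoidHom.ext fun h => by
            show a (h (k + l)) = a (h k) + a (h l)
            rw [map_add, map_add]))
        (fun a b => AddMonoidHom.ext fun k => AddMonoidHom.ext fun h => rfl))
      (fun r a k => AddMonoidHom.ext fun h => by
        show (r • a) (h k) = a (h (r • k))
        rw [map_zsmul, map_zsmul]
        rfl))
    (by
      refine (AddSubgroup.closure_le _).2 ?_
      rintro x ⟨a, r, k, rfl⟩
      rw [SetLike.mem_coe, AddMonoidHom.mem_ker, map_sub, sub_eq_zero]
      refine AddMonoidHom.ext fun h => ?_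
      show a (r • h k) = a (h (r • k))
      rw [LinearMap.map_smul])

theorem tau_tm (a : CharMod M) (k : A) (h : A →ₗ[R] M) : tau M A (tm R a k) h = a (h k) := rfl

theorem tau_map (g : A →ₗ[R] B) (x : BTen R (CharMod M) A) (h : B →ₗ[R] M) :
    tau M B (BTen.mapRight R (CharMod M) g x) h = tau M A x (h ∘ₗ g) := by
  induction x using bt_ind with
  | h0 => simp
  | h1 a k => rfl
  | h2 x y hx hy => simp only [map_add, AddMonoidHom.add_apply, hx, hy]

theorem free_form (k : ℕ) (x : BTen R (CharMod M) (Fin k → R)) :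
    ∃ a : Fin k → CharMod M, x = ∑ i, tm R (a i) (Pi.single i (1 : R) : Fin k → R) := by
  induction x using bt_ind with
  | h0 => exact ⟨0, by simp [tm_zero_left]⟩
  | h1 a v =>
    refine ⟨fun i => MulOpposite.op (v i) • a, ?_⟩
    simp only [tm_smul]
    rw [← tm_sum_right]
    congr 1
    ext j
    simp [Finset.sum_apply, Pi.single_apply]
  | h2 x y hx hy =>
    obtain ⟨a, rfl⟩ := hx
    obtain ⟨b, rfl⟩ := hy
    exact ⟨a + b, by simp [tm_add_left, Finset.sum_add_distrib]⟩

noncomputable def hmap (k : ℕ) (i : Fin k) : M →+ ((Fin k → R) →ₗ[R] M) :=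
  AddMonoidHom.mk' (fun m => (LinearMap.toSpanSingleton R M m) ∘ₗ LinearMap.proj i)
    (fun a b => by ext; simp)

theorem tau_free_inj (k : ℕ) : Function.Injective (tau (R := R) M (Fin k → R)) := by
  rw [injective_iff_map_eq_zero]
  intro x hx
  obtain ⟨a, rfl⟩ := free_form M k x
  refine Finset.sum_eq_zero fun i _ => ?_
  have : a i = 0 := by
    refine AddMonoidHom.ext fun m => ?_
    have h := DFunLike.congr_fun hx (hmap M k i m)
    rw [map_sum, AddMonoidHom.finsetSum_apply, Finset.sum_eq_single i] at h
    · rw [tau_tm] at h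
      have h2 : a i m = 0 := by simpa [hmap] using h
      exact h2
    · intro j _ hj
      rw [tau_tm]
      simp [hmap, Pi.single_apply, hj.symm]
    · simp
  rw [this, tm_zero_left]

theorem tau_free_surj (k : ℕ) : Function.Surjective (tau (R := R) M (Fin k → R)) := by
  intro φ
  refine ⟨∑ i, tm R (φ.comp (hmap M k i) : CharMod M) (Pi.single i (1 : R) : Fin k → R), ?_⟩
  refine AddMonoidHom.ext fun h => ?_
  rw [map_sum, AddMonoidHom.finsetSum_apply]
  have : h = ∑ i, hmap M k i (h (Pi.single i 1)) := by
    ext j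
    simp [hmap, Pi.single_apply, Finset.sum_ite_eq]
  conv_rhs => rw [this, map_sum]
  rfl

theorem tau_surj (hA : Module.Finite R A) : Function.Surjective (tau (R := R) M A) := by
  obtain ⟨k, g, hg⟩ := Module.Finite.exists_fin' R A
  intro φ
  obtain ⟨ψ, hψ⟩ := char_ext
    (AddMonoidHom.mk' (fun h : A →ₗ[R] M => h ∘ₗ g) (fun a b => LinearMap.add_comp _ _ _))
    (fun a b hab => by
      ext x
      obtain ⟨y, rfl⟩ := hg x
      exact DFunLike.congr_fun hab y) φ
  obtain ⟨s, hs⟩ := tau_free_surj M k ψ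
  refine ⟨BTen.mapRight R _ g s, AddMonoidHom.ext fun h => ?_⟩
  rw [tau_map, hs]
  exact hψ h

theorem tau_inj {k : ℕ} (g : (Fin k → R) →ₗ[R] A) (hg : Function.Surjective g)
    (hL : Module.Finite R (LinearMap.ker g)) : Function.Injective (tau (R := R) M A) := by
  rw [injective_iff_map_eq_zero]
  intro t ht
  obtain ⟨s, rfl⟩ := map_surj g hg t
  obtain ⟨ψ, hψ⟩ := char_ext_ker
    (AddMonoidHom.mk' (fun h : (Fin k → R) →ₗ[R] M => h ∘ₗ (LinearMap.ker g).subtype)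
      (fun a b => LinearMap.add_comp _ _ _)) (tau M _ s) (by
      intro h hh
      have hk : LinearMap.ker g ≤ LinearMap.ker h := fun x hx =>
        DFunLike.congr_fun hh (⟨x, hx⟩ : LinearMap.ker g)
      let h' : A →ₗ[R] M := (LinearMap.ker g).liftQ h hk ∘ₗ
        (g.quotKerEquivOfSurjective hg).symm.toLinearMap
      have e : h' ∘ₗ g = h := by
        refine LinearMap.ext fun x => ?_
        have : (g.quotKerEquivOfSurjective hg).symm (g x) = Submodule.Quotient.mk x := by
          rw [LinearEquiv.symm_apply_eq]; rfl
        simp only [h', LinearMap.comp_apply, LinearEquiv.coe_coe]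
        rw [this]
        rfl
      have := DFunLike.congr_fun ht h'
      rwa [tau_map, e] at this)
  obtain ⟨w, rfl⟩ := tau_surj M hL ψ
  have hs : s = BTen.mapRight R _ (LinearMap.ker g).subtype w := by
    apply tau_free_inj
    refine AddMonoidHom.ext fun h => ?_
    rw [tau_map]
    exact (hψ h).symm
  have h0 : g ∘ₗ (LinearMap.ker g).subtype = 0 := by
    ext x; exact x.2
  rw [hs, map_map, h0, map_zero']

end Tau

section Ext
variable {R : Type u} [Ring R] {M K P : Type u} [AddCommGroup M] [Module R M]
  [AddCommGroup K] [Module R K] [AddCommGroup P] [Module R P]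

theorem ext_to_extend (p : P →ₗ[R] K) (hp : Function.Surjective p) (h : Ext1Zero R K M)
    (f : LinearMap.ker p →ₗ[R] M) : ∃ g : P →ₗ[R] M, g ∘ₗ (LinearMap.ker p).subtype = f := by
  let N : Submodule R (M × P) := LinearMap.range (f.prod (-(LinearMap.ker p).subtype))
  have hN (x : M × P) (hx : x ∈ N) : ∃ w : LinearMap.ker p, f w = x.1 ∧ -(w : P) = x.2 := by
    obtain ⟨w, rfl⟩ := hx
    exact ⟨w, rfl, rfl⟩
  let i : M →ₗ[R] (M × P) ⧸ N := N.mkQ ∘ₗ LinearMap.inl R M P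
  let q : ((M × P) ⧸ N) →ₗ[R] K := N.liftQ (p ∘ₗ LinearMap.snd R M P) (by
    intro x hx
    obtain ⟨w, _, h2⟩ := hN x hx
    have : p w = 0 := w.2
    simp [← h2, this])
  obtain ⟨r, hr⟩ := h _ i q
    (by
      rw [injective_iff_map_eq_zero]
      intro m hm
      obtain ⟨w, h1, h2⟩ := hN _ ((Submodule.Quotient.mk_eq_zero N).1 hm)
      have hw : w = 0 := Subtype.ext (neg_eq_zero.1 h2)
      rw [hw, map_zero] at h1
      exact h1.symm)
    (by
      intro k
      obtain ⟨x, rfl⟩ := hp k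
      exact ⟨N.mkQ (0, x), rfl⟩)
    (by
      ext x
      constructor
      · rintro ⟨m, rfl⟩
        exact map_zero p
      · intro hx
        obtain ⟨⟨m, y⟩, rfl⟩ := N.mkQ_surjective x
        have hy : p y = 0 := hx
        refine ⟨m + f ⟨y, hy⟩, ?_⟩
        refine (Submodule.Quotient.eq N).2 ⟨⟨y, hy⟩, ?_⟩
        simp)
  refine ⟨r ∘ₗ N.mkQ ∘ₗ LinearMap.inr R M P, ?_⟩
  ext w
  have e : N.mkQ (0, (w : P)) = i (f w) := by
    refine ((Submodule.Quotient.eq N).2 ⟨-w, ?_⟩)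
    simp
  show r (N.mkQ (0, (w : P))) = f w
  rw [e]
  exact DFunLike.congr_fun hr (f w)

theorem extend_to_ext [Module.Projective R P] (p : P →ₗ[R] K) (hp : Function.Surjective p)
    (H : ∀ f : LinearMap.ker p →ₗ[R] M, ∃ g : P →ₗ[R] M, g ∘ₗ (LinearMap.ker p).subtype = f) :
    Ext1Zero R K M := by
  intro X _ _ i q hi hq hiq
  obtain ⟨h, hh⟩ := Module.projective_lifting_property q p hq
  have e (x) : q (h x) = p x := DFunLike.congr_fun hh x
  let ie := LinearEquiv.ofInjective i hi
  obtain ⟨g, hg⟩ := H (ie.symm.toLinearMap ∘ₗ (h ∘ₗ (LinearMap.ker p).subtype).codRestrict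
    (LinearMap.range i) (fun w => by
      rw [hiq, LinearMap.mem_ker]
      exact (e _).trans w.2))
  have hg' (w : P) (hw : p w = 0) : i (g w) = h w := by
    have h1 := DFunLike.congr_fun hg (⟨w, hw⟩ : LinearMap.ker p)
    have h2 : g w = _ := h1
    rw [h2]
    have h3 := fun y => congrArg Subtype.val (ie.apply_symm_apply y)
    exact h3 _
  have hle : LinearMap.ker p ≤ LinearMap.ker (h - i ∘ₗ g) := fun w hw => by
    simp [hg' w hw]
  let s : K →ₗ[R] X := (LinearMap.ker p).liftQ (h - i ∘ₗ g) hle ∘ₗ (p.quotKerEquivOfSurjective hp).symm.toLinearMap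
  have hex : Function.Exact i q := LinearMap.exact_iff.2 hiq.symm
  have hs : q ∘ₗ s = LinearMap.id := by
    ext k
    obtain ⟨x, rfl⟩ := hp k
    have h1 : (p.quotKerEquivOfSurjective hp).symm (p x) = Submodule.Quotient.mk x := by
      rw [LinearEquiv.symm_apply_eq]; rfl
    show q ((LinearMap.ker p).liftQ (h - i ∘ₗ g) hle
      ((p.quotKerEquivOfSurjective hp).symm (p x))) = p x
    rw [h1]
    show q (h x - i (g x)) = p x
    rw [map_sub, hex.apply_apply_eq_zero, sub_zero, e]
  have key : (Function.Injective i ∧ ∃ l, q ∘ₗ l = LinearMap.id) ↔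
      (Function.Surjective q ∧ ∃ l, l ∘ₗ i = LinearMap.id) := hex.split_tfae'.out 0 1
  exact (key.1 ⟨hi, s, hs⟩).2

end Ext

theorem fin_of_pres {R : Type u} [Ring R] {M : Type u} [AddCommGroup M] [Module R M]
    {n : ℕ} (h : FinNPres R n M) : Module.Finite R M := by
  cases n with
  | zero => exact h
  | succ n =>
    obtain ⟨k, f, hf, _⟩ := h
    exact Module.Finite.of_surjective f hf

theorem main {R : Type u} [Ring R] {M K : Type u} [AddCommGroup M] [Module R M]
    [AddCommGroup K] [Module R K] {n : ℕ} (hK : FinNPres R (n + 2) K) :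
    Ext1Zero R K M ↔ Tor1Zero R (CharMod M) K := by
  obtain ⟨k, p, hp, m, g, hg, hL⟩ := hK
  have hL' := fin_of_pres hL
  have hΩ : Module.Finite R (LinearMap.ker p) := Module.Finite.of_surjective g hg
  constructor
  · intro h
    refine tor_indep p hp ?_
    rw [injective_iff_map_eq_zero]
    intro t ht
    apply tau_inj M g hg hL'
    refine AddMonoidHom.ext fun f => ?_
    obtain ⟨f', rfl⟩ := ext_to_extend p hp h f
    rw [← tau_map, ht]
    simp
  · intro h
    have hinj := h (Fin k → R) inferInstance p hp
    refine extend_to_ext p hp ?_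
    refine surj_of_char (AddMonoidHom.mk'
      (fun h : (Fin k → R) →ₗ[R] M => h ∘ₗ (LinearMap.ker p).subtype)
      (fun a b => LinearMap.add_comp _ _ _)) ?_
    intro φ hφ
    obtain ⟨t, rfl⟩ := tau_surj M hΩ φ
    have : t = 0 := by
      apply hinj
      apply tau_free_inj
      refine AddMonoidHom.ext fun f => ?_
      rw [tau_map, map_zero, map_zero]
      exact hφ f
    rw [this, map_zero]

end FPdAux

/-- For `n ≥ 2`, a left `R`-module `M` is `FPₙ^{≤d}`-injective if and only if its character
module `M⋆ = Hom_ℤ(M, ℚ/ℤ)` is `FPₙ^{≤d}`-flat as a right `R`-module. -/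
theorem fpdInj_iff_charMod_fpdFlat (R : Type u) [Ring R] (n : ℕ) (hn : 2 ≤ n)
    (d : ℕ∞) (hd : 1 ≤ d) (M : Type u) [AddCommGroup M] [Module R M] :
    FPdInj R n d M ↔ FPdFlat R n d (CharMod M) := by
  obtain ⟨n, rfl⟩ := Nat.exists_eq_add_of_le' hn
  exact ⟨fun h K _ _ h1 h2 => (FPdAux.main h1).1 (h K h1 h2),
    fun h K _ _ h1 h2 => (FPdAux.main h1).2 (h K h1 h2)⟩
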